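/- Let G be a finite multigraph and K a field of characteristic 0. For every k ≥ 0, the dimension over K of the k-th graded component of B_G^{F_1} (the case t = 1) equals the number of subforests T of G with external activity act_G(T) = e(G) − |T| − k. -/

import Mathlib

open MvPolynomial

namespace ForestAlg

variable {V E : Type*}

/-- Two vertices are directly connected by an edge of `A`. -/
def edgeRel (ends : E → Sym2 V) (A : Finset E) (v w : V) : Prop :=
  ∃ e ∈ A, ends e = s(v, w)

/-- Number of connected components of the spanning subgraph `(V, A)`. -/
noncomputable def numComponents (ends : E → Sym2 V) (A : Finset E) : ℕ :=
  Nat.card (Quot (edgeRel ends A))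

/-- Rank `r(A) = v(G) - c(V,A)`. -/
noncomputable def rank (ends : E → Sym2 V) (A : Finset E) : ℕ :=
  Nat.card V - numComponents ends A

/-- `A` is a subforest (contains no cycle): `|A| = v(G) - c(V,A)`. -/
def IsForest (ends : E → Sym2 V) (A : Finset E) : Prop :=
  A.card + numComponents ends A = Nat.card V

/-- The Tutte polynomial, evaluated at `(x, y)`. -/
noncomputable def tutte [Fintype E] {R : Type*} [CommRing R]
    (ends : E → Sym2 V) (x y : R) : R :=
  ∑ A ∈ (Finset.univ : Finset E).powerset,
    (x - 1) ^ (rank ends Finset.univ - rank ends A) *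
      (y - 1) ^ (A.card - rank ends A)

/-- `e ∉ F` is externally active for the subforest `F` with respect to the linear
order `o`: `F + e` contains a cycle and `e` is the minimal edge of that cycle
(the edges of the unique cycle of `F + e` are those whose removal does not
decrease the rank). -/
def ExtActive [DecidableEq E] (o : LinearOrder E) (ends : E → Sym2 V)
    (F : Finset E) (e : E) : Prop :=
  e ∉ F ∧ ¬ IsForest ends (insert e F) ∧
    ∀ f ∈ insert e F,
      rank ends ((insert e F).erase f) = rank ends (insert e F) → o.le e f

/-- External activity `act_G(F)`. -/
noncomputable def act [DecidableEq E] (o : LinearOrder E) (ends : E → Sym2 V)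
    (F : Finset E) : ℕ :=
  Set.ncard {e : E | ExtActive o ends F e}

/-- `D_I`: number of edges with one endpoint in `I` and the other outside `I`. -/
noncomputable def crossCount {n : ℕ} (ends : E → Sym2 (Fin n))
    (I : Finset (Fin n)) : ℕ :=
  Set.ncard {e : E | (∃ v ∈ ends e, v ∈ I) ∧ ∃ w ∈ ends e, w ∉ I}

/-- The ideal `J_G^{F_t}` generated by `(∑_{i ∈ I} x_i)^{t·D_I + 1}` over nonempty `I`. -/
noncomputable def forestIdeal (K : Type*) [Field K] {n : ℕ} (t : ℕ)
    (ends : E → Sym2 (Fin n)) : Ideal (MvPolynomial (Fin n) K) :=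
  Ideal.span {p | ∃ I : Finset (Fin n), I.Nonempty ∧
    p = (∑ i ∈ I, X i) ^ (t * crossCount ends I + 1)}

/-- The `k`-th graded component of `K[x_1,…,x_n]/J` (for homogeneous `J`):
the image of the degree-`k` homogeneous part in the quotient. -/
noncomputable def gradedPiece (K : Type*) [Field K] {n : ℕ}
    (J : Ideal (MvPolynomial (Fin n) K)) (k : ℕ) :
    Submodule K (MvPolynomial (Fin n) K ⧸ J) :=
  Submodule.map (Ideal.Quotient.mkₐ K J).toLinearMap
    (homogeneousSubmodule (Fin n) K k)

/-- Dimension of the `k`-th graded component of the quotient. -/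
noncomputable def gradedDim (K : Type*) [Field K] {n : ℕ}
    (J : Ideal (MvPolynomial (Fin n) K)) (k : ℕ) : ℕ :=
  Module.finrank K (gradedPiece K J k)


lemma exists_eq_mk (z : Sym2 V) : ∃ a b, z = s(a, b) :=
  Sym2.ind (fun a b => ⟨a, b, rfl⟩) z

section Components

variable {ends : E → Sym2 V} {A B : Finset E}

lemma edgeRel.mono (h : A ⊆ B) {v w : V} (hr : edgeRel ends A v w) : edgeRel ends B v w :=
  let ⟨e, he, hvw⟩ := hr
  ⟨e, h he, hvw⟩

/-- Two vertices lie in the same connected component of `(V, A)`. -/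
def Conn (ends : E → Sym2 V) (A : Finset E) (v w : V) : Prop :=
  Quot.mk (edgeRel ends A) v = Quot.mk (edgeRel ends A) w

lemma Conn.mono (h : A ⊆ B) {v w : V} (hc : Conn ends A v w) : Conn ends B v w :=
  congrArg (Quot.map id fun _ _ hr => edgeRel.mono h hr) hc

lemma conn_of_mem {e : E} (he : e ∈ A) {i j : V} (hij : ends e = s(i, j)) : Conn ends A i j :=
  Quot.sound ⟨e, he, hij⟩

lemma numComponents_le [Finite V] : numComponents ends A ≤ Nat.card V :=
  Nat.card_le_card_of_surjective (Quot.mk _) Quot.mk_surjective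

lemma numComponents_empty : numComponents ends ∅ = Nat.card V := by
  refine (Nat.card_congr (Equiv.ofBijective (Quot.mk _) ⟨fun v w h => ?_, Quot.mk_surjective⟩)).symm
  have h' := Quot.eqvGen_exact h
  clear h
  induction h' with
  | rel x y hr => obtain ⟨f, hf, -⟩ := hr; simp at hf
  | refl x => rfl
  | symm x y _ ih => exact ih.symm
  | trans x y z _ _ ih₁ ih₂ => exact ih₁.trans ih₂

lemma rank_eq_rank_iff [Finite V] :
    rank ends A = rank ends B ↔ numComponents ends A = numComponents ends B := by
  have hA := numComponents_le (ends := ends) (A := A)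
  have hB := numComponents_le (ends := ends) (A := B)
  unfold rank
  omega

lemma isForest_empty : IsForest ends (∅ : Finset E) := by
  simp [IsForest, numComponents_empty]

variable [DecidableEq E] {e : E} {i j : V}

lemma Conn.of_insert (hij : ends e = s(i, j)) {v w : V} (h : Conn ends (insert e A) v w) :
    Conn ends A v w ∨ (Conn ends A v i ∧ Conn ends A j w) ∨
      (Conn ends A v j ∧ Conn ends A i w) := by
  have h' := Quot.eqvGen_exact h
  unfold Conn
  clear h
  induction h' with
  | rel x y hr =>
    obtain ⟨f, hf, hxy⟩ := hr
    rcases Finset.mem_insert.1 hf with rfl | hf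
    · rw [hij, Sym2.eq_iff] at hxy
      grind
    · exact Or.inl (conn_of_mem hf hxy)
  | refl x => exact Or.inl rfl
  | symm x y _ ih => grind
  | trans x y z _ _ ih₁ ih₂ => grind

lemma numComponents_insert_of_conn (hij : ends e = s(i, j)) (h : Conn ends A i j) :
    numComponents ends (insert e A) = numComponents ends A := by
  refine (Nat.card_congr (Equiv.ofBijective
    (fun x : Quot (edgeRel ends A) => (Quot.map id (fun _ _ hr =>
      edgeRel.mono (Finset.subset_insert e A) hr) x : Quot (edgeRel ends (insert e A))))
    ⟨?_, ?_⟩)).symm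
  · rintro ⟨v⟩ ⟨w⟩ hvw
    have := Conn.of_insert hij (v := v) (w := w) hvw
    unfold Conn at *
    grind
  · rintro ⟨v⟩
    exact ⟨Quot.mk _ v, rfl⟩

lemma numComponents_insert_of_not_conn [Finite V] (hij : ends e = s(i, j))
    (h : ¬ Conn ends A i j) :
    numComponents ends A = numComponents ends (insert e A) + 1 := by
  classical
  let q : Quot (edgeRel ends A) → Quot (edgeRel ends (insert e A)) :=
    Quot.map id fun _ _ hr => edgeRel.mono (Finset.subset_insert e A) hr
  have hq : ∀ v, q (Quot.mk _ v) = Quot.mk _ v := fun v => rfl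
  have hij' : Conn ends (insert e A) i j := conn_of_mem (Finset.mem_insert_self e A) hij
  have : Finite (Quot (edgeRel ends (insert e A))) := Quot.finite _
  unfold numComponents
  rw [← Finite.card_option]
  refine Nat.card_congr (Equiv.ofBijective
    (fun x => if x = Quot.mk _ j then none else some (q x)) ⟨?_, ?_⟩)
  · rintro ⟨v⟩ ⟨w⟩ hvw
    have := fun h => Conn.of_insert hij (A := A) (v := v) (w := w) h
    simp only [hq] at hvw
    unfold Conn at *
    grind
  · rintro (_ | ⟨⟨v⟩⟩)
    · exact ⟨Quot.mk _ j, by simp⟩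
    · by_cases hv : Conn ends A v j
      · refine ⟨Quot.mk _ i, ?_⟩
        have h1 := hv.mono (Finset.subset_insert e A)
        unfold Conn at *
        simp only [hq]
        grind
      · refine ⟨Quot.mk _ v, ?_⟩
        unfold Conn at *
        simp only [hq]
        grind

lemma numComponents_contract [Finite V] [DecidableEq V] (hij : ends e = s(i, j)) (hne : i ≠ j) :
    numComponents (fun f => (ends f).map (Function.update id j i)) A
      = numComponents ends (insert e A) + 1 := by
  have hc : Conn ends (insert e A) i j := conn_of_mem (Finset.mem_insert_self e A) hij
  have : Finite (Quot (edgeRel ends (insert e A))) := Quot.finite _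
  have hφ : ∀ v, Conn ends (insert e A) (Function.update id j i v) v := by
    intro v
    rcases eq_or_ne v j with rfl | hv
    · simpa using hc
    · simp [hv, Conn]
  have hφj : ∀ v, Function.update id j i v ≠ j := by
    intro v
    rcases eq_or_ne v j with rfl | hv <;> simp [*]
  unfold numComponents
  rw [← Finite.card_option]
  refine Nat.card_congr
    { toFun := Quot.lift (fun v => if v = j then none else some (Quot.mk _ v)) ?_
      invFun := fun x => x.elim (Quot.mk _ j)
        (Quot.lift (fun v => Quot.mk _ (Function.update id j i v)) ?_)
      left_inv := ?_
      right_inv := ?_ }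
  · rintro v w ⟨f, hf, hvw⟩
    obtain ⟨a, b, hab⟩ := exists_eq_mk (ends f)
    have h1 : Conn ends (insert e A) a b := conn_of_mem (Finset.mem_insert_of_mem hf) hab
    have ha := hφ a
    have hb := hφ b
    have ha' := hφj a
    have hb' := hφj b
    simp only [hab, Sym2.map_mk, Sym2.eq_iff] at hvw
    unfold Conn at *
    grind
  · rintro v w ⟨f, hf, hvw⟩
    rcases Finset.mem_insert.1 hf with rfl | hf
    · rw [hij, Sym2.eq_iff] at hvw
      obtain ⟨rfl, rfl⟩ | ⟨rfl, rfl⟩ := hvw <;> simp [hne]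
    · exact Quot.sound ⟨f, hf, by simp only [hvw, Sym2.map_mk]⟩
  · rintro ⟨v⟩
    rcases eq_or_ne v j with rfl | hv <;> simp [*]
  · rintro (_ | ⟨⟨v⟩⟩)
    · simp
    · have := hφ v
      unfold Conn at this
      simp [hφj, this]

variable [Finite V]

lemma card_le_card_add_numComponents : Nat.card V ≤ A.card + numComponents ends A := by
  induction A using Finset.induction_on with
  | empty => simp [numComponents_empty]
  | insert e A he ih =>
    obtain ⟨a, b, hab⟩ := exists_eq_mk (ends e)
    rw [Finset.card_insert_of_notMem he]
    by_cases h : Conn ends A a b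
    · rw [numComponents_insert_of_conn hab h]; omega
    · rw [numComponents_insert_of_not_conn hab h] at ih; omega

lemma isForest_insert_iff_contract [DecidableEq V] (hij : ends e = s(i, j)) (hne : i ≠ j)
    (he : e ∉ A) : IsForest ends (insert e A) ↔
      IsForest (fun f => (ends f).map (Function.update id j i)) A := by
  unfold IsForest
  rw [numComponents_contract hij hne, Finset.card_insert_of_notMem he]
  omega

lemma not_isForest_insert_iff (hij : ends e = s(i, j)) (he : e ∉ A) (hA : IsForest ends A) :
    ¬ IsForest ends (insert e A) ↔ Conn ends A i j := by
  unfold IsForest at *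
  rw [Finset.card_insert_of_notMem he]
  by_cases h : Conn ends A i j
  · rw [numComponents_insert_of_conn hij h]; simp only [h, iff_true]; omega
  · rw [numComponents_insert_of_not_conn hij h] at hA; simp only [h, iff_false]; omega

end Components

section Activity

variable [DecidableEq E] [Finite V] {ends : E → Sym2 V} {A : Finset E} {o : LinearOrder E}
  {e : E} {i j : V}

lemma extActive_loop (hij : ends e = s(i, i)) (he : e ∉ A) (hA : IsForest ends A) :
    ExtActive o ends A e := by
  refine ⟨he, (not_isForest_insert_iff hij he hA).2 rfl, fun g hg hr => ?_⟩
  rcases Finset.mem_insert.1 hg with rfl | hgA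
  · exact o.le_refl _
  · exfalso
    have hge : e ≠ g := fun h => he (h ▸ hgA)
    rw [rank_eq_rank_iff, Finset.erase_insert_of_ne hge, numComponents_insert_of_conn hij rfl,
      numComponents_insert_of_conn hij rfl] at hr
    have := card_le_card_add_numComponents (ends := ends) (A := A.erase g)
    have h2 := Finset.card_erase_add_one hgA
    unfold IsForest at hA
    omega

lemma not_isForest_of_loop_mem (hij : ends e = s(i, i)) (he : e ∉ A) :
    ¬ IsForest ends (insert e A) := by
  unfold IsForest
  rw [numComponents_insert_of_conn hij rfl, Finset.card_insert_of_notMem he]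
  have := card_le_card_add_numComponents (ends := ends) (A := A)
  omega

lemma not_extActive_of_max (hij : ends e = s(i, j)) (hne : i ≠ j) (hA : IsForest ends A)
    (hmax : ∀ f ∈ A, o.lt f e) : ¬ ExtActive o ends A e := by
  rintro ⟨he, hnf, hmin⟩
  have hc : Conn ends A i j := (not_isForest_insert_iff hij he hA).1 hnf
  obtain ⟨H, hHA, hH⟩ : ∃ H ⊆ A, Minimal (fun H => Conn ends H i j) H := by
    obtain ⟨H, hle, hH⟩ := exists_minimal_le_of_wellFoundedLT (fun H => Conn ends H i j) A hc
    exact ⟨H, hle, hH⟩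
  obtain ⟨g, hg⟩ : H.Nonempty := by
    rw [Finset.nonempty_iff_ne_empty]
    rintro rfl
    have := hH.prop
    have h0 := numComponents_insert_of_conn hij this
    classical
    have h2 := numComponents_contract (A := ∅) hij hne
    rw [numComponents_empty] at h0 h2
    omega
  obtain ⟨a, b, hab⟩ := exists_eq_mk (ends g)
  have hgA := hHA hg
  have hnc : ¬ Conn ends (H.erase g) i j := fun h =>
    (Finset.erase_ssubset hg).not_subset (hH.2 h (Finset.erase_subset _ _))
  have h1 : Conn ends (insert g (H.erase g)) i j := by
    rw [Finset.insert_erase hg]; exact hH.prop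
  have h2 : H.erase g ⊆ (insert e A).erase g :=
    Finset.erase_subset_erase _ (hHA.trans (Finset.subset_insert _ _))
  have hne' : e ≠ g := fun h => he (h ▸ hgA)
  have h3 : Conn ends ((insert e A).erase g) i j :=
    conn_of_mem (by simp [hne']) hij
  have h4 : Conn ends ((insert e A).erase g) a b := by
    rcases h1.of_insert hab with h | ⟨h, h'⟩ | ⟨h, h'⟩
    · exact absurd h hnc
    · exact ((h.mono h2).symm.trans h3).trans (h'.mono h2).symm
    · exact ((h'.mono h2).trans h3.symm).trans (h.mono h2)
  have h5 := hmin g (Finset.mem_insert_of_mem hgA) <| by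
    rw [rank_eq_rank_iff, ← numComponents_insert_of_conn hab h4,
      Finset.insert_erase (Finset.mem_insert_of_mem hgA)]
  exact absurd h5 (@not_le_of_gt E _ _ _ (hmax g hgA))

lemma extActive_insert_iff_contract [DecidableEq V] (hij : ends e = s(i, j)) (hne : i ≠ j)
    (he : e ∉ A) {f : E} (hf : o.lt f e) : ExtActive o ends (insert e A) f ↔
      ExtActive o (fun f => (ends f).map (Function.update id j i)) A f := by
  have hfe : f ≠ e := @ne_of_lt E _ _ _ hf
  have hcomm : insert f (insert e A) = insert e (insert f A) := Finset.insert_comm _ _ _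
  have he' : e ∉ insert f A := by simp [he, hfe.symm]
  unfold ExtActive
  rw [hcomm, isForest_insert_iff_contract hij hne he']
  refine and_congr (by simp [hfe]) (and_congr Iff.rfl ?_)
  rw [Finset.forall_mem_insert]
  refine (and_iff_right fun _ => @le_of_lt E _ _ _ hf).trans (forall₂_congr fun g hg => ?_)
  have hge : e ≠ g := fun h => he' (h ▸ hg)
  rw [rank_eq_rank_iff, rank_eq_rank_iff, numComponents_contract hij hne,
    numComponents_contract hij hne, Finset.erase_insert_of_ne hge, Nat.add_right_cancel_iff]

end Activity

section ForestCount

variable [DecidableEq E]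

open Classical in
/-- The number of subforests `A ⊆ S` whose number of externally active edges within `S` is
`|S| - |A| - k`. -/
noncomputable def forestCount (o : LinearOrder E) (ends : E → Sym2 V) (S : Finset E) (k : ℕ) : ℕ :=
  (S.powerset.filter fun A =>
    IsForest ends A ∧ (S.filter (ExtActive o ends A)).card + A.card + k = S.card).card

variable {o : LinearOrder E} {ends : E → Sym2 V} {S : Finset E} {e : E} {i j : V} {k : ℕ}

lemma forestCount_empty : forestCount o ends ∅ k = if k = 0 then 1 else 0 := by
  unfold forestCount
  rw [Finset.card_filter]
  simp [isForest_empty]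

lemma natCard_subforests [Fintype E] : Nat.card {A : Finset E // IsForest ends A ∧
    act o ends A + A.card + k = Fintype.card E} = forestCount o ends Finset.univ k := by
  classical
  rw [Nat.card_eq_fintype_card, Fintype.card_subtype, forestCount]
  congr 1
  ext A
  simp [act, Set.ncard_eq_toFinset_card']

variable [Finite V]

lemma forestCount_insert_loop (hij : ends e = s(i, i)) (he : e ∉ S) :
    forestCount o ends (insert e S) k = forestCount o ends S k := by
  classical
  unfold forestCount
  rw [Finset.card_filter, Finset.card_filter, Finset.sum_powerset_insert he,
    add_eq_left.2 (Finset.sum_eq_zero fun A hA => ?_)]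
  · refine Finset.sum_congr rfl fun A hA => if_congr (and_congr_right fun hF => ?_) rfl rfl
    have heA : e ∉ A := fun h => he (Finset.mem_powerset.1 hA h)
    rw [Finset.filter_insert, if_pos (extActive_loop hij heA hF),
      Finset.card_insert_of_notMem (by simp [he]), Finset.card_insert_of_notMem he]
    omega
  · have heA : e ∉ A := fun h => he (Finset.mem_powerset.1 hA h)
    exact if_neg fun h => not_isForest_of_loop_mem hij heA h.1

/-- Deletion-contraction along the largest edge, when that edge is not a loop. -/
lemma forestCount_insert_of_ne [DecidableEq V] (hij : ends e = s(i, j)) (hne : i ≠ j)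
    (hmax : ∀ f ∈ S, o.lt f e) :
    forestCount o ends (insert e S) k =
      forestCount o (fun f => (ends f).map (Function.update id j i)) S k +
        if k = 0 then 0 else forestCount o ends S (k - 1) := by
  classical
  have he : e ∉ S := fun h => @lt_irrefl E _ e (hmax e h)
  have hcard : ∀ A ∈ S.powerset, (S.filter (ExtActive o ends A)).card + A.card ≤ S.card := by
    intro A hA
    rw [← Finset.card_union_of_disjoint]
    · exact Finset.card_le_card
        (Finset.union_subset (Finset.filter_subset _ _) (Finset.mem_powerset.1 hA))
    · rw [Finset.disjoint_left]
      intro f hf hfA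
      exact (Finset.mem_filter.1 hf).2.1 hfA
  unfold forestCount
  rw [Finset.card_filter, Finset.card_filter, Finset.card_filter, Finset.sum_powerset_insert he,
    add_comm]
  congr 1
  · refine Finset.sum_congr rfl fun A hA => if_congr ?_ rfl rfl
    have hAS := Finset.mem_powerset.1 hA
    have heA : e ∉ A := fun h => he (hAS h)
    have hf : S.filter (ExtActive o ends (insert e A)) = S.filter
        (ExtActive o (fun f => (ends f).map (Function.update id j i)) A) :=
      Finset.filter_congr fun f hf => extActive_insert_iff_contract hij hne heA (hmax f hf)
    rw [isForest_insert_iff_contract hij hne heA, Finset.filter_insert,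
      if_neg (fun h => h.1 (Finset.mem_insert_self _ _)), Finset.card_insert_of_notMem heA,
      Finset.card_insert_of_notMem he, hf]
    refine and_congr_right fun _ => ?_
    omega
  · have key : ∀ A ∈ S.powerset, (IsForest ends A ∧
        ((insert e S).filter (ExtActive o ends A)).card + A.card + k = (insert e S).card) ↔
        (IsForest ends A ∧ (S.filter (ExtActive o ends A)).card + A.card + k = S.card + 1) := by
      intro A hA
      have hAS := Finset.mem_powerset.1 hA
      refine and_congr_right fun hF => ?_
      rw [Finset.filter_insert, if_neg (not_extActive_of_max hij hne hF fun f hf =>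
        hmax f (hAS hf)), Finset.card_insert_of_notMem he]
    split_ifs with hk
    · refine Finset.sum_eq_zero fun A hA => if_neg ?_
      rw [key A hA]
      have := hcard A hA
      omega
    · refine Finset.sum_congr rfl fun A hA => if_congr ?_ rfl rfl
      rw [key A hA]
      refine and_congr_right fun _ => ?_
      omega

end ForestCount

section LocallyNilpotent

variable {K R : Type*} [Field K] [CharZero K] [CommRing R] [Algebra K R]
  {D : Derivation K R R} {y : R} {c : K}

lemma exists_mem_span_derivation_eq (hc : c ≠ 0) (hy : D y = algebraMap K R c)
    (hD : ∀ f, ∃ m : ℕ, ((D : R →ₗ[K] R) ^ m) f = 0) (q : R) (d : ℕ) :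
    ∃ f ∈ Ideal.span {y ^ (d + 1)}, D f = q * y ^ d := by
  obtain ⟨m, hm⟩ := hD q
  induction m generalizing q d with
  | zero =>
    have hq : q = 0 := by simpa using hm
    exact ⟨0, zero_mem _, by simp [hq]⟩
  | succ m ih =>
    have hcd : c * ((d + 1 : ℕ) : K) ≠ 0 := mul_ne_zero hc (Nat.cast_ne_zero.2 d.succ_ne_zero)
    set b : K := (c * ((d + 1 : ℕ) : K))⁻¹ with hb
    obtain ⟨g, hg, hDg⟩ := ih (-(b • D q)) (d + 1) (by
      rw [pow_succ, Module.End.mul_apply, Derivation.coeFn_coe] at hm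
      rw [map_neg, map_smul, hm, smul_zero, neg_zero])
    refine ⟨b • (q * y ^ (d + 1)) + g, add_mem ?_ ?_, ?_⟩
    · rw [Algebra.smul_def]
      exact Ideal.mul_mem_left _ _ (Ideal.mul_mem_left _ _ (Ideal.mem_span_singleton_self _))
    · exact (Ideal.span_singleton_le_span_singleton.2 (pow_dvd_pow y (Nat.le_succ _))) hg
    · have h1 : algebraMap K R b * (algebraMap K R c * ((d + 1 : ℕ) : R)) = 1 := by
        rw [← map_natCast (algebraMap K R), ← map_mul, ← map_mul, hb, inv_mul_cancel₀ hcd, map_one]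
      rw [map_add, hDg, D.map_smul, D.leibniz, D.leibniz_pow, hy]
      simp only [smul_eq_mul, nsmul_eq_mul, Nat.add_sub_cancel]
      simp only [Algebra.smul_def]
      linear_combination (q * y ^ d) * h1

lemma eq_zero_of_natCast_mul_add_mul_derivation (hc : c ≠ 0) (hy : D y = algebraMap K R c)
    (hD : ∀ f, ∃ m : ℕ, ((D : R →ₗ[K] R) ^ m) f = 0) {m : ℕ} (hm : m ≠ 0) {h : R}
    (hh : ((m : K) * c) • h + y * D h = 0) : h = 0 := by
  obtain ⟨N, hN⟩ := hD h
  induction N generalizing m h with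
  | zero => simpa using hN
  | succ N ih =>
    have hDh : D h = 0 := by
      refine ih (m := m + 1) (Nat.succ_ne_zero m) ?_ (by
        rwa [pow_succ, Module.End.mul_apply] at hN)
      have := congrArg D hh
      rw [map_add, D.map_smul, D.leibniz, hy, map_zero] at this
      rw [← this]
      simp only [smul_eq_mul]
      simp only [Algebra.smul_def, map_mul, Nat.cast_add, Nat.cast_one, map_add, map_one]
      ring
    rw [hDh, mul_zero, add_zero] at hh
    exact (smul_eq_zero.1 hh).resolve_left (mul_ne_zero (Nat.cast_ne_zero.2 hm) hc)

end LocallyNilpotent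

section EdgeDeriv

variable {K : Type*} [Field K]

/-- The derivation `∂_a - ∂_b` attached to an edge from `a` to `b`. -/
noncomputable def edgeDeriv (K : Type*) [Field K] (a b : V) :
    Derivation K (MvPolynomial V K) (MvPolynomial V K) :=
  pderiv a - pderiv b

lemma edgeDeriv_X [DecidableEq V] (a b v : V) : edgeDeriv K a b (X v) =
    C ((if v = a then 1 else 0) - (if v = b then 1 else 0)) := by
  rw [edgeDeriv, Derivation.sub_apply, pderiv_X, pderiv_X, map_sub]
  congr 1 <;> simp [Pi.single_apply, apply_ite]

lemma edgeDeriv_self (a : V) : edgeDeriv K a a = 0 := sub_self _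

lemma edgeDeriv_sum_X [DecidableEq V] (a b : V) (I : Finset V) : edgeDeriv K a b (∑ v ∈ I, X v) =
    C ((if a ∈ I then 1 else 0) - (if b ∈ I then 1 else 0)) := by
  simp_rw [map_sum, edgeDeriv_X]
  rw [← map_sum, Finset.sum_sub_distrib, Finset.sum_ite_eq', Finset.sum_ite_eq']

lemma edgeDeriv_mem_homogeneousSubmodule (a b : V) {m : ℕ} {f : MvPolynomial V K}
    (hf : f ∈ homogeneousSubmodule V K (m + 1)) :
    edgeDeriv K a b f ∈ homogeneousSubmodule V K m :=
  sub_mem (IsHomogeneous.pderiv hf) (IsHomogeneous.pderiv hf)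

lemma edgeDeriv_of_mem_homogeneousSubmodule_zero (a b : V) {f : MvPolynomial V K}
    (hf : f ∈ homogeneousSubmodule V K 0) : edgeDeriv K a b f = 0 := by
  rw [mem_homogeneousSubmodule, ← totalDegree_zero_iff_isHomogeneous,
    totalDegree_eq_zero_iff_eq_C] at hf
  rw [hf, ← algebraMap_eq, Derivation.map_algebraMap]

lemma exists_edgeDeriv_pow_eq_zero (a b : V) (f : MvPolynomial V K) :
    ∃ m : ℕ, ((edgeDeriv K a b : MvPolynomial V K →ₗ[K] MvPolynomial V K) ^ m) f = 0 := by
  have key : ∀ (m : ℕ) (g : MvPolynomial V K), g ∈ homogeneousSubmodule V K m →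
      ((edgeDeriv K a b : MvPolynomial V K →ₗ[K] MvPolynomial V K) ^ (m + 1)) g = 0 := by
    intro m
    induction m with
    | zero => intro g hg; simpa using edgeDeriv_of_mem_homogeneousSubmodule_zero a b hg
    | succ m ih =>
      intro g hg
      rw [pow_succ, Module.End.mul_apply]
      exact ih _ (edgeDeriv_mem_homogeneousSubmodule a b hg)
  refine ⟨f.totalDegree + 1, ?_⟩
  have hf := congrArg
    ((edgeDeriv K a b : MvPolynomial V K →ₗ[K] MvPolynomial V K) ^ (f.totalDegree + 1))
    f.sum_homogeneousComponent
  rw [← hf, map_sum]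
  refine Finset.sum_eq_zero fun i hi => ?_
  obtain ⟨r, hr⟩ := Nat.exists_eq_add_of_le (Nat.succ_le_of_lt (Finset.mem_range.1 hi))
  rw [hr, add_comm, pow_add, Module.End.mul_apply, key i _ (homogeneousComponent_mem i f), map_zero]

lemma homogeneousComponent_edgeDeriv (a b : V) (m : ℕ) (f : MvPolynomial V K) :
    homogeneousComponent m (edgeDeriv K a b f) =
      edgeDeriv K a b (homogeneousComponent (m + 1) f) := by
  have key : ∀ (i : ℕ) (g : MvPolynomial V K), g ∈ homogeneousSubmodule V K i →
      homogeneousComponent m (edgeDeriv K a b g) =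
        edgeDeriv K a b (homogeneousComponent (m + 1) g) := by
    rintro (_ | i) g hg
    · rw [edgeDeriv_of_mem_homogeneousSubmodule_zero a b hg, homogeneousComponent_of_mem hg,
        if_neg (Nat.succ_ne_zero m), map_zero, map_zero]
    · rw [homogeneousComponent_of_mem (edgeDeriv_mem_homogeneousSubmodule a b hg),
        homogeneousComponent_of_mem hg]
      by_cases h : m = i <;> simp [h]
  rw [← f.sum_homogeneousComponent]
  simp only [map_sum]
  exact Finset.sum_congr rfl fun i _ => key i _ (homogeneousComponent_mem i f)

variable [DecidableEq V] [CharZero K]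

lemma exists_edgeDeriv_eq {i j : V} (hne : i ≠ j) (q : MvPolynomial V K) :
    ∃ f, edgeDeriv K i j f = q := by
  have hy : edgeDeriv K i j (X j) = algebraMap K _ (-1) := by
    rw [edgeDeriv_X, algebraMap_eq]; simp [hne.symm]
  obtain ⟨f, -, hf⟩ := exists_mem_span_derivation_eq (neg_ne_zero.2 one_ne_zero) hy
    (exists_edgeDeriv_pow_eq_zero i j) q 0
  exact ⟨f, by simpa using hf⟩

lemma dualMap_edgeDeriv_injective {i j : V} (hne : i ≠ j) : Function.Injective
    (LinearMap.dualMap (edgeDeriv K i j : MvPolynomial V K →ₗ[K] MvPolynomial V K)) :=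
  LinearMap.dualMap_injective_of_surjective fun q => exists_edgeDeriv_eq hne q

end EdgeDeriv

section InverseSystem

variable {K : Type*} [Field K]

open Classical in
/-- The number of edges in `S` with exactly one endpoint in `I`, for a graph given by source and
target maps. -/
noncomputable def cutCount (src tgt : E → V) (S : Finset E) (I : Finset V) : ℕ :=
  (S.filter fun e => ¬ (src e ∈ I ↔ tgt e ∈ I)).card

/-- The ideal `J^{F_1}` of the spanning subgraph with edge set `S`. -/
noncomputable def cutIdeal (K : Type*) [Field K] (src tgt : E → V) (S : Finset E) :
    Ideal (MvPolynomial V K) :=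
  Ideal.span (Set.range fun I : Finset V => (∑ v ∈ I, X v) ^ (cutCount src tgt S I + 1))

/-- The linear functionals vanishing on `cutIdeal` and on all homogeneous polynomials of degree
different from `k`: the degree `k` part of the inverse system of `cutIdeal`. -/
noncomputable def inverseSystem (K : Type*) [Field K] (src tgt : E → V) (S : Finset E) (k : ℕ) :
    Submodule K (Module.Dual K (MvPolynomial V K)) where
  carrier := {l | (∀ f ∈ cutIdeal K src tgt S, l f = 0) ∧
    ∀ m ≠ k, ∀ f ∈ homogeneousSubmodule V K m, l f = 0}
  add_mem' := fun ha hb => ⟨fun f hf => by simp [ha.1 f hf, hb.1 f hf],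
    fun m hm f hf => by simp [ha.2 m hm f hf, hb.2 m hm f hf]⟩
  zero_mem' := ⟨fun _ _ => rfl, fun _ _ _ _ => rfl⟩
  smul_mem' := fun c _ ha => ⟨fun f hf => by simp [ha.1 f hf],
    fun m hm f hf => by simp [ha.2 m hm f hf]⟩

/-- The functional `f ↦ (∂_{e₁} ⋯ ∂_{e_r} f)(0)`. -/
noncomputable def edgeFunctional (K : Type*) [Field K] (src tgt : E → V) :
    List E → Module.Dual K (MvPolynomial V K)
  | [] => (aeval (fun _ => (0 : K))).toLinearMap
  | e :: l => edgeFunctional K src tgt l ∘ₗ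
      (edgeDeriv K (src e) (tgt e) : MvPolynomial V K →ₗ[K] MvPolynomial V K)

/-- The span of the functionals attached to the `k`-element subsets of `S`. -/
noncomputable def edgeSpan (K : Type*) [Field K] (src tgt : E → V) (S : Finset E) (k : ℕ) :
    Submodule K (Module.Dual K (MvPolynomial V K)) :=
  Submodule.span K
    (edgeFunctional K src tgt '' {l : List E | l.Nodup ∧ (∀ e ∈ l, e ∈ S) ∧ l.length = k})

variable {src tgt : E → V} {S : Finset E} {e : E} {k : ℕ}

lemma edgeSpan_mono {S' : Finset E} (h : S ⊆ S') :
    edgeSpan K src tgt S k ≤ edgeSpan K src tgt S' k :=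
  Submodule.span_mono (Set.image_mono fun _ hl => ⟨hl.1, fun e he => h (hl.2.1 e he), hl.2.2⟩)

lemma map_dualMap_edgeSpan_le [DecidableEq E] (he : e ∉ S) :
    (edgeSpan K src tgt S k).map (LinearMap.dualMap
      (edgeDeriv K (src e) (tgt e) : MvPolynomial V K →ₗ[K] MvPolynomial V K)) ≤
      edgeSpan K src tgt (insert e S) (k + 1) := by
  unfold edgeSpan
  rw [Submodule.map_span, Submodule.span_le]
  rintro _ ⟨_, ⟨l, ⟨h1, h2, h3⟩, rfl⟩, rfl⟩
  refine Submodule.subset_span ⟨e :: l, ⟨List.nodup_cons.2 ⟨fun h => he (h2 e h), h1⟩, ?_, ?_⟩, rfl⟩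
  · simpa using fun f hf => Or.inr (h2 f hf)
  · simpa using h3

lemma edgeFunctional_eq_zero_of_mem_homogeneousSubmodule (l : List E) {m : ℕ} (hm : m ≠ l.length)
    {f : MvPolynomial V K} (hf : f ∈ homogeneousSubmodule V K m) :
    edgeFunctional K src tgt l f = 0 := by
  induction l generalizing m f with
  | nil =>
    have h0 : coeff 0 f = 0 := IsHomogeneous.coeff_eq_zero hf (by simpa using hm.symm)
    simp [edgeFunctional, aeval_zero', constantCoeff_eq, h0]
  | cons e l ih =>
    rcases m with _ | m
    · simp [edgeFunctional, edgeDeriv_of_mem_homogeneousSubmodule_zero _ _ hf]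
    · exact ih (m := m) (by simpa using hm) (edgeDeriv_mem_homogeneousSubmodule _ _ hf)

open Classical in
lemma edgeFunctional_eq_zero_of_mem_span (I : Finset V) (l : List E) {d : ℕ}
    (hd : (l.filter fun e => ¬ (src e ∈ I ↔ tgt e ∈ I)).length ≤ d) {f : MvPolynomial V K}
    (hf : f ∈ Ideal.span {(∑ v ∈ I, X v : MvPolynomial V K) ^ (d + 1)}) :
    edgeFunctional K src tgt l f = 0 := by
  induction l generalizing d f with
  | nil =>
    obtain ⟨q, rfl⟩ := Ideal.mem_span_singleton'.1 hf
    simp [edgeFunctional]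
  | cons e l ih =>
    obtain ⟨q, rfl⟩ := Ideal.mem_span_singleton'.1 hf
    rw [edgeFunctional, LinearMap.comp_apply, Derivation.coeFn_coe, Derivation.leibniz,
      Derivation.leibniz_pow, edgeDeriv_sum_X]
    by_cases h : src e ∈ I ↔ tgt e ∈ I
    · rw [List.filter_cons_of_neg (by simpa using h)] at hd
      refine ih hd (Ideal.mem_span_singleton'.2 ⟨edgeDeriv K (src e) (tgt e) q, ?_⟩)
      simp [h, mul_comm]
    · rw [List.filter_cons_of_pos (by simpa using h), List.length_cons] at hd
      obtain ⟨d, rfl⟩ : ∃ d', d = d' + 1 := ⟨d - 1, by omega⟩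
      refine ih (d := d) (by omega) (Ideal.mem_span_singleton.2 (dvd_add ?_ ?_))
      · refine Dvd.dvd.mul_left ?_ _
        rw [nsmul_eq_mul, Nat.add_sub_cancel]
        exact Dvd.dvd.mul_left (Dvd.intro _ rfl) _
      · exact Dvd.dvd.mul_right (pow_dvd_pow _ (Nat.le_succ _)) _

lemma edgeFunctional_mem_inverseSystem {l : List E} (hl : l.Nodup) (hS : ∀ e ∈ l, e ∈ S) :
    edgeFunctional K src tgt l ∈ inverseSystem K src tgt S l.length := by
  classical
  refine ⟨fun f hf => ?_, fun m hm f hf =>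
    edgeFunctional_eq_zero_of_mem_homogeneousSubmodule l hm hf⟩
  have hle : cutIdeal K src tgt S ≤ ⨆ I : Finset V,
      Ideal.span {(∑ v ∈ I, X v) ^ (cutCount src tgt S I + 1)} := by
    refine Ideal.span_le.2 ?_
    rintro _ ⟨I, rfl⟩
    exact Ideal.mem_iSup_of_mem (i := I) (Ideal.mem_span_singleton_self _)
  refine Submodule.iSup_induction _ (motive := fun f => edgeFunctional K src tgt l f = 0) (hle hf)
    (fun I g hg => edgeFunctional_eq_zero_of_mem_span I l ?_ hg) (map_zero _)
    (fun a b ha hb => by rw [map_add, ha, hb, add_zero])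
  rw [cutCount, ← List.toFinset_card_of_nodup (hl.filter _)]
  refine Finset.card_le_card fun e he => ?_
  simp only [List.mem_toFinset, List.mem_filter] at he
  exact Finset.mem_filter.2 ⟨hS e he.1, by simpa using he.2⟩

lemma edgeSpan_le_inverseSystem : edgeSpan K src tgt S k ≤ inverseSystem K src tgt S k := by
  refine Submodule.span_le.2 ?_
  rintro _ ⟨l, ⟨h1, h2, rfl⟩, rfl⟩
  exact edgeFunctional_mem_inverseSystem h1 h2

instance [Finite E] : FiniteDimensional K (edgeSpan K src tgt S k) :=
  FiniteDimensional.span_of_finite K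
    (((List.finite_length_eq E k).subset fun _ hl => hl.2.2).image _)

/-- The substitution dual to identifying vertices along `φ`. -/
noncomputable def contractHom [Fintype V] [DecidableEq V] (K : Type*) [Field K] (φ : V → V) :
    MvPolynomial V K →ₐ[K] MvPolynomial V K :=
  aeval fun u => ∑ v with φ v = u, X v

variable [Fintype V] [DecidableEq V]

lemma contractHom_sum_X (φ : V → V) (I : Finset V) :
    contractHom K φ (∑ u ∈ I, X u) = ∑ v with φ v ∈ I, X v := by
  simp_rw [map_sum, contractHom, aeval_X, Finset.sum_filter]
  rw [Finset.sum_comm]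
  refine Finset.sum_congr rfl fun v _ => ?_
  rw [Finset.sum_ite_eq]

lemma filter_update_eq {i j : V} (hne : i ≠ j) (v : V) :
    (Finset.univ.filter fun w => Function.update id j i w = v) =
      if v = j then ∅ else if v = i then {i, j} else {v} := by
  ext w
  by_cases hw : w = j <;> by_cases hv : v = j <;> by_cases hv' : v = i <;>
    simp_all [Function.update_apply, eq_comm]

lemma contractHom_X_sub_mem {i j : V} (hne : i ≠ j) (f : MvPolynomial V K) :
    f - contractHom K (Function.update id j i) f ∈ Ideal.span {(X j : MvPolynomial V K)} := by
  rw [← Ideal.Quotient.eq]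
  have : (Ideal.Quotient.mkₐ K (Ideal.span {(X j : MvPolynomial V K)})) =
      (Ideal.Quotient.mkₐ K (Ideal.span {(X j : MvPolynomial V K)})).comp
        (contractHom K (Function.update id j i)) := by
    ext v
    have hj : Ideal.Quotient.mk (Ideal.span {(X j : MvPolynomial V K)}) (X j) = 0 :=
      Ideal.Quotient.eq_zero_iff_mem.2 (Ideal.mem_span_singleton_self _)
    rw [AlgHom.comp_apply, contractHom, aeval_X, filter_update_eq hne]
    split_ifs with h h'
    · simp [h, hj]
    · simp [Finset.sum_pair hne, h', hj]
    · simp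
  exact congrArg (fun h => h f) this

lemma contractHom_mem_homogeneousSubmodule (φ : V → V) {m : ℕ} {f : MvPolynomial V K}
    (hf : f ∈ homogeneousSubmodule V K m) : contractHom K φ f ∈ homogeneousSubmodule V K m := by
  have := IsHomogeneous.aeval hf (fun u => ∑ v with φ v = u, X v)
    (fun u => IsHomogeneous.sum _ _ 1 fun v _ => isHomogeneous_X K v)
  rwa [one_mul] at this

lemma edgeDeriv_contractHom (φ : V → V) (a b : V) (f : MvPolynomial V K) :
    edgeDeriv K a b (contractHom K φ f) = contractHom K φ (edgeDeriv K (φ a) (φ b) f) := by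
  induction f using MvPolynomial.induction_on with
  | C c => simp [← algebraMap_eq]
  | add p q hp hq => simp only [map_add, hp, hq]
  | mul_X p u hp =>
    have hX : edgeDeriv K a b (contractHom K φ (X u)) =
        contractHom K φ (edgeDeriv K (φ a) (φ b) (X u)) := by
      have := contractHom_sum_X (K := K) φ {u}
      rw [Finset.sum_singleton] at this
      rw [this, edgeDeriv_sum_X, edgeDeriv_X, ← algebraMap_eq, AlgHom.commutes]
      simp [eq_comm]
    rw [map_mul, Derivation.leibniz, Derivation.leibniz, hp, hX]
    simp only [smul_eq_mul, map_add, map_mul]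

lemma edgeFunctional_contract (φ : V → V) (l : List E) :
    edgeFunctional K (φ ∘ src) (φ ∘ tgt) l =
      (contractHom K φ).toLinearMap.dualMap (edgeFunctional K src tgt l) := by
  induction l with
  | nil =>
    ext f
    have : (aeval fun _ => (0 : K)) = (aeval fun _ => (0 : K)).comp (contractHom K φ) := by
      ext u; simp [contractHom]
    exact congrArg (fun h : MvPolynomial V K →ₐ[K] K => h _) this
  | cons e l ih =>
    refine LinearMap.ext fun f => ?_
    have := congrArg (fun h => h (edgeDeriv K (φ (src e)) (φ (tgt e)) f)) ih
    simpa [edgeFunctional, edgeDeriv_contractHom] using this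

lemma edgeSpan_contract (φ : V → V) : edgeSpan K (φ ∘ src) (φ ∘ tgt) S k =
    (edgeSpan K src tgt S k).map (contractHom K φ).toLinearMap.dualMap := by
  unfold edgeSpan
  rw [Submodule.map_span, Set.image_image]
  simp_rw [edgeFunctional_contract]

lemma cutCount_contract [DecidableEq E] (φ : V → V) (he : φ (src e) = φ (tgt e)) (I : Finset V) :
    cutCount (φ ∘ src) (φ ∘ tgt) S I =
      cutCount src tgt (insert e S) (Finset.univ.filter fun v => φ v ∈ I) := by
  unfold cutCount
  rw [Finset.filter_insert, if_neg (by simp [he])]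
  simp

lemma map_dualMap_inverseSystem_le [DecidableEq E] (φ : V → V) (he : φ (src e) = φ (tgt e)) :
    (inverseSystem K src tgt (insert e S) k).map (contractHom K φ).toLinearMap.dualMap ≤
      inverseSystem K (φ ∘ src) (φ ∘ tgt) S k := by
  rintro _ ⟨l, hl, rfl⟩
  refine ⟨fun f hf => hl.1 _ ?_, fun m hm f hf =>
    hl.2 m hm _ (contractHom_mem_homogeneousSubmodule φ hf)⟩
  have hle : cutIdeal K (φ ∘ src) (φ ∘ tgt) S ≤
      (cutIdeal K src tgt (insert e S)).comap (contractHom K φ) := by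
    refine Ideal.span_le.2 ?_
    rintro _ ⟨I, rfl⟩
    refine Ideal.subset_span ⟨Finset.univ.filter fun v => φ v ∈ I, ?_⟩
    simp only [map_pow, contractHom_sum_X, cutCount_contract φ he]
  exact hle hf

end InverseSystem

section DeletionContraction

variable {K : Type*} [Field K] {src tgt : E → V} {S : Finset E} {e : E} {k : ℕ}
  [DecidableEq V] [CharZero K]

lemma exists_mem_cutIdeal_edgeDeriv_eq [DecidableEq E] (he : e ∉ S) (hne : src e ≠ tgt e)
    {h : MvPolynomial V K} (hh : h ∈ cutIdeal K src tgt S) :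
    ∃ f ∈ cutIdeal K src tgt (insert e S), edgeDeriv K (src e) (tgt e) f = h := by
  suffices H : ∀ q, ∃ f ∈ cutIdeal K src tgt (insert e S),
      edgeDeriv K (src e) (tgt e) f = q * h by simpa using H 1
  unfold cutIdeal at hh
  induction hh using Submodule.span_induction with
  | zero => exact fun q => ⟨0, zero_mem _, by simp⟩
  | add a b _ _ ha hb =>
    intro q
    obtain ⟨f, hf, hf'⟩ := ha q
    obtain ⟨g, hg, hg'⟩ := hb q
    exact ⟨f + g, add_mem hf hg, by rw [map_add, hf', hg', mul_add]⟩
  | smul r a _ ha =>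
    intro q
    obtain ⟨f, hf, hf'⟩ := ha (q * r)
    exact ⟨f, hf, by rw [hf', smul_eq_mul, mul_assoc]⟩
  | mem x hx =>
    obtain ⟨I, rfl⟩ := hx
    intro q
    have hgen : (∑ v ∈ I, X v) ^ (cutCount src tgt (insert e S) I + 1) ∈
        cutIdeal K src tgt (insert e S) := Ideal.subset_span ⟨I, rfl⟩
    have hy := edgeDeriv_sum_X (K := K) (src e) (tgt e) I
    by_cases hI : src e ∈ I ↔ tgt e ∈ I
    · have hcut : cutCount src tgt (insert e S) I = cutCount src tgt S I := by
        unfold cutCount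
        rw [Finset.filter_insert, if_neg (not_not.2 hI)]
      obtain ⟨f, hf⟩ := exists_edgeDeriv_eq hne q
      refine ⟨f * _, Ideal.mul_mem_left _ f hgen, ?_⟩
      rw [Derivation.leibniz, Derivation.leibniz_pow, hy, hf, hcut]
      simp [hI, mul_comm]
    · have hcut : cutCount src tgt (insert e S) I = cutCount src tgt S I + 1 := by
        unfold cutCount
        rw [Finset.filter_insert, if_pos hI, Finset.card_insert_of_notMem (by simp [he])]
      have hc : ((if src e ∈ I then 1 else 0) - (if tgt e ∈ I then 1 else 0) : K) ≠ 0 := by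
        by_cases h1 : src e ∈ I <;> by_cases h2 : tgt e ∈ I <;> simp_all
      rw [← algebraMap_eq] at hy
      obtain ⟨f, hf, hf'⟩ := exists_mem_span_derivation_eq hc hy
        (exists_edgeDeriv_pow_eq_zero _ _) q (cutCount src tgt S I + 1)
      rw [← hcut] at hf
      exact ⟨f, (Ideal.span_singleton_le_iff_mem _).2 hgen hf, hf'⟩

variable [Fintype V]

lemma contractHom_eq_self {i j : V} (hne : i ≠ j) {f : MvPolynomial V K}
    (hf : edgeDeriv K i j f = 0) : contractHom K (Function.update id j i) f = f := by
  obtain ⟨h, hh⟩ := Ideal.mem_span_singleton'.1 (contractHom_X_sub_mem hne f)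
  have hy : edgeDeriv K i j (X j) = algebraMap K _ (-1) := by
    rw [edgeDeriv_X, algebraMap_eq]; simp [hne.symm]
  have h0 : edgeDeriv K i j (h * X j) = 0 := by
    rw [hh, map_sub, hf, edgeDeriv_contractHom]
    simp [hne, edgeDeriv_self]
  rw [Derivation.leibniz, hy] at h0
  have := eq_zero_of_natCast_mul_add_mul_derivation (m := 1) (h := h)
    (neg_ne_zero.2 one_ne_zero) hy (exists_edgeDeriv_pow_eq_zero i j) one_ne_zero (by
      rw [← h0]; simp [Algebra.smul_def])
  rw [this, zero_mul] at hh
  exact (sub_eq_zero.1 hh.symm).symm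

lemma exists_eq_dualMap_edgeDeriv [DecidableEq E] (he : e ∉ S) (hne : src e ≠ tgt e)
    {l : Module.Dual K (MvPolynomial V K)} (hl : l ∈ inverseSystem K src tgt (insert e S) k)
    (h0 : (contractHom K (Function.update id (tgt e) (src e))).toLinearMap.dualMap l = 0) :
    ∃ l' : Module.Dual K (MvPolynomial V K), (∀ f ∈ cutIdeal K src tgt S, l' f = 0) ∧
      (∀ m, m + 1 ≠ k → ∀ f ∈ homogeneousSubmodule V K m, l' f = 0) ∧
      LinearMap.dualMap
        (edgeDeriv K (src e) (tgt e) : MvPolynomial V K →ₗ[K] MvPolynomial V K) l' = l := by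
  obtain ⟨g, hg⟩ := LinearMap.exists_rightInverse_of_surjective
    (edgeDeriv K (src e) (tgt e) : MvPolynomial V K →ₗ[K] MvPolynomial V K)
    (LinearMap.range_eq_top.2 fun q => exists_edgeDeriv_eq hne q)
  have hg' : ∀ f, edgeDeriv K (src e) (tgt e) (g f) = f := fun f => congrArg (fun h => h f) hg
  have hker : ∀ f, edgeDeriv K (src e) (tgt e) f = 0 → l f = 0 := by
    intro f hf
    rw [← contractHom_eq_self hne hf]
    exact congrArg (fun h => h f) h0
  have hlg : ∀ f, l (g (edgeDeriv K (src e) (tgt e) f)) = l f := by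
    intro f
    rw [← sub_eq_zero, ← map_sub]
    exact hker _ (by rw [map_sub, hg', sub_self])
  refine ⟨l ∘ₗ g, fun f hf => ?_, fun m hm f hf => ?_, LinearMap.ext hlg⟩
  · obtain ⟨f', hf', rfl⟩ := exists_mem_cutIdeal_edgeDeriv_eq he hne hf
    exact (hlg f').trans (hl.1 f' hf')
  · obtain ⟨f', rfl⟩ := exists_edgeDeriv_eq hne f
    rw [← homogeneousComponent_eq_self hf, homogeneousComponent_edgeDeriv]
    exact (hlg _).trans (hl.2 (m + 1) hm _ (homogeneousComponent_mem _ _))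

lemma inverseSystem_inf_ker_zero [DecidableEq E] (he : e ∉ S) (hne : src e ≠ tgt e) :
    inverseSystem K src tgt (insert e S) 0 ⊓ LinearMap.ker
      (contractHom K (Function.update id (tgt e) (src e))).toLinearMap.dualMap = ⊥ := by
  rw [eq_bot_iff]
  rintro l ⟨hl, h0⟩
  obtain ⟨l', -, h2, rfl⟩ := exists_eq_dualMap_edgeDeriv he hne hl h0
  have : l' = 0 := by
    refine LinearMap.ext fun f => ?_
    rw [← f.sum_homogeneousComponent]
    rw [map_sum]
    exact Finset.sum_eq_zero fun m _ => h2 m (Nat.succ_ne_zero m) _ (homogeneousComponent_mem m f)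
  rw [this, map_zero]
  exact zero_mem _

lemma inverseSystem_inf_ker_succ_le [DecidableEq E] (he : e ∉ S) (hne : src e ≠ tgt e) :
    inverseSystem K src tgt (insert e S) (k + 1) ⊓ LinearMap.ker
      (contractHom K (Function.update id (tgt e) (src e))).toLinearMap.dualMap ≤
    (inverseSystem K src tgt S k).map (LinearMap.dualMap
      (edgeDeriv K (src e) (tgt e) : MvPolynomial V K →ₗ[K] MvPolynomial V K)) := by
  rintro l ⟨hl, h0⟩
  obtain ⟨l', h1, h2, rfl⟩ := exists_eq_dualMap_edgeDeriv he hne hl h0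
  exact ⟨l', ⟨h1, fun m hm => h2 m (by omega)⟩, rfl⟩

end DeletionContraction

section Dimension

variable {K : Type*} [Field K] {src tgt : E → V} {S : Finset E} {k : ℕ}

lemma homogeneousComponent_mem_cutIdeal {f : MvPolynomial V K} (hf : f ∈ cutIdeal K src tgt S) :
    homogeneousComponent k f ∈ cutIdeal K src tgt S := by
  let _ := gradedAlgebra (σ := V) (R := K)
  refine homogeneousComponent_mem_of_mem (Ideal.homogeneous_span _ _ ?_) hf k
  rintro _ ⟨I, rfl⟩
  exact ⟨_, (IsHomogeneous.sum I _ 1 fun v _ => isHomogeneous_X K v).pow _⟩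

/-- The degree `k` part of the inverse system is dual to the degree `k` part of the quotient. -/
lemma finrank_inverseSystem {n : ℕ} {src tgt : E → Fin n} :
    Module.finrank K (inverseSystem K src tgt S k) = gradedDim K (cutIdeal K src tgt S) k := by
  set J := cutIdeal K src tgt S
  rw [gradedDim, ← Subspace.dual_finrank_eq]
  let π : MvPolynomial (Fin n) K →ₗ[K] gradedPiece K J k :=
    ((Ideal.Quotient.mkₐ K J).toLinearMap ∘ₗ homogeneousComponent k).codRestrict _
      fun f => Submodule.mem_map_of_mem (homogeneousComponent_mem k f)
  have hπ : ∀ f, (π f : MvPolynomial (Fin n) K ⧸ J) =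
      Ideal.Quotient.mk J (homogeneousComponent k f) := fun f => rfl
  have hsurj : Function.Surjective π := by
    rintro ⟨_, f, hf, rfl⟩
    refine ⟨f, Subtype.ext ?_⟩
    rw [hπ, homogeneousComponent_eq_self hf]
    rfl
  have hrange : LinearMap.range π.dualMap = inverseSystem K src tgt S k := by
    rw [LinearMap.range_dualMap_eq_dualAnnihilator_ker]
    ext l
    rw [Submodule.mem_dualAnnihilator]
    have hker : ∀ f, f ∈ LinearMap.ker π ↔ homogeneousComponent k f ∈ J := fun f => by
      rw [LinearMap.mem_ker, ← Subtype.coe_inj, hπ, Submodule.coe_zero,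
        Ideal.Quotient.eq_zero_iff_mem]
    constructor
    · intro hl
      refine ⟨fun f hf => hl f ((hker f).2 (homogeneousComponent_mem_cutIdeal hf)),
        fun m hm f hf => hl f ((hker f).2 ?_)⟩
      rw [homogeneousComponent_of_mem hf, if_neg hm.symm]
      exact zero_mem _
    · intro hl f hf
      rw [hker] at hf
      rw [← f.sum_homogeneousComponent, map_sum]
      refine Finset.sum_eq_zero fun m _ => ?_
      rcases eq_or_ne m k with rfl | hm
      · exact hl.1 _ hf
      · exact hl.2 m hm _ (homogeneousComponent_mem m f)
  rw [← hrange]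
  exact LinearMap.finrank_range_of_inj (LinearMap.dualMap_injective_of_surjective hsurj)

lemma finrank_inverseSystem_empty (src tgt : E → V) (k : ℕ) :
    inverseSystem K src tgt ∅ k ≤ edgeSpan K src tgt ∅ k ∧
      Module.finrank K (inverseSystem K src tgt ∅ k) = if k = 0 then 1 else 0 := by
  have hX : ∀ v : V, X v ∈ cutIdeal K src tgt ∅ := by
    intro v
    have : (∑ u ∈ {v}, X u : MvPolynomial V K) ^ (cutCount src tgt ∅ {v} + 1) ∈
      cutIdeal K src tgt ∅ := Ideal.subset_span ⟨{v}, rfl⟩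
    simpa [cutCount] using this
  have hl : ∀ l ∈ inverseSystem K src tgt ∅ k, l = l 1 • edgeFunctional K src tgt [] := by
    intro l hl
    refine LinearMap.ext fun f => ?_
    induction f using MvPolynomial.induction_on with
    | C c =>
      rw [← algebraMap_eq, Algebra.algebraMap_eq_smul_one]
      simp [edgeFunctional, mul_comm]
    | add p q hp hq => rw [map_add, hp, hq, map_add]
    | mul_X p v _ =>
      rw [hl.1 _ (Ideal.mul_mem_left _ _ (hX v))]
      simp [edgeFunctional]
  have h0 : edgeFunctional K src tgt [] ∈ inverseSystem K src tgt ∅ 0 :=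
    edgeFunctional_mem_inverseSystem List.nodup_nil (by simp)
  rcases eq_or_ne k 0 with rfl | hk
  · have h1 : edgeFunctional K src tgt [] ≠ 0 := fun h => by
      have := congrArg (fun h => h 1) h
      simp [edgeFunctional] at this
    have heq : inverseSystem K src tgt ∅ 0 = K ∙ edgeFunctional K src tgt [] := by
      refine le_antisymm (fun l h => ?_) ((Submodule.span_singleton_le_iff_mem _ _).2 h0)
      rw [hl l h]
      exact Submodule.smul_mem _ _ (Submodule.mem_span_singleton_self _)
    refine ⟨?_, by rw [heq, finrank_span_singleton h1, if_pos rfl]⟩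
    rw [heq, Submodule.span_singleton_le_iff_mem]
    exact Submodule.subset_span ⟨[], by simp, rfl⟩
  · have heq : inverseSystem K src tgt ∅ k = ⊥ := by
      rw [eq_bot_iff]
      intro l h
      rw [hl l h, h.2 0 hk.symm 1 (isHomogeneous_one V K), zero_smul]
      exact zero_mem _
    rw [heq, if_neg hk, finrank_bot]
    exact ⟨bot_le, rfl⟩

lemma finrank_eq_finrank_map_add {W W' : Type*} [AddCommGroup W] [Module K W] [AddCommGroup W']
    [Module K W'] (f : W →ₗ[K] W') (Q : Submodule K W) [FiniteDimensional K Q] :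
    Module.finrank K Q = Module.finrank K (Q.map f) +
      Module.finrank K (Q ⊓ LinearMap.ker f : Submodule K W) := by
  rw [← LinearMap.finrank_range_add_finrank_ker (f.domRestrict Q), LinearMap.range_domRestrict,
    LinearMap.ker_domRestrict, ← Submodule.map_comap_subtype,
    LinearEquiv.finrank_eq (Submodule.equivMapOfInjective Q.subtype Q.injective_subtype _)]

variable [Fintype V] [DecidableEq V] [Finite E] [CharZero K]

theorem inverseSystem_eq_edgeSpan_and_finrank [DecidableEq E] (o : LinearOrder E) (S : Finset E)
    (src tgt : E → V) (k : ℕ) :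
    inverseSystem K src tgt S k = edgeSpan K src tgt S k ∧
      Module.finrank K (inverseSystem K src tgt S k) =
        forestCount o (fun e => s(src e, tgt e)) S k := by
  induction hN : S.card generalizing S src tgt k with
  | zero =>
    obtain rfl := Finset.card_eq_zero.1 hN
    rw [forestCount_empty]
    exact ⟨le_antisymm (finrank_inverseSystem_empty src tgt k).1 edgeSpan_le_inverseSystem,
      (finrank_inverseSystem_empty src tgt k).2⟩
  | succ N ih =>
    obtain ⟨e, heS, hmax⟩ := S.exists_max_image id (Finset.card_pos.1 (by omega))
    obtain ⟨S, he, rfl⟩ : ∃ S', e ∉ S' ∧ S = insert e S' :=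
      ⟨S.erase e, Finset.notMem_erase e S, (Finset.insert_erase heS).symm⟩
    rw [Finset.card_insert_of_notMem he] at hN
    replace ih := fun src tgt k => ih S src tgt k (by omega)
    by_cases hne : src e = tgt e
    · have hJ : inverseSystem K src tgt (insert e S) k = inverseSystem K src tgt S k := by
        have : cutIdeal K src tgt (insert e S) = cutIdeal K src tgt S := by
          unfold cutIdeal cutCount
          simp_rw [Finset.filter_insert, hne, not_true_eq_false, if_false]
        simp only [inverseSystem, this]
      rw [forestCount_insert_loop (i := src e) (by rw [hne]) he, hJ]
      refine ⟨le_antisymm ((ih src tgt k).1.le.trans (edgeSpan_mono (Finset.subset_insert e S))) ?_,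
        (ih src tgt k).2⟩
      rw [← hJ]
      exact edgeSpan_le_inverseSystem
    · set φ := Function.update id (tgt e) (src e) with hφ
      have hφe : φ (src e) = φ (tgt e) := by simp [hφ, hne]
      set T := (contractHom K φ).toLinearMap.dualMap with hT
      set M := LinearMap.dualMap
        (edgeDeriv K (src e) (tgt e) : MvPolynomial V K →ₗ[K] MvPolynomial V K)
      have hker : inverseSystem K src tgt (insert e S) k ⊓ LinearMap.ker T ≤
          edgeSpan K src tgt (insert e S) k := by
        rcases k with _ | k
        · rw [hT, inverseSystem_inf_ker_zero he hne]
          exact bot_le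
        · refine (inverseSystem_inf_ker_succ_le he hne).trans ?_
          rw [(ih src tgt k).1]
          exact map_dualMap_edgeSpan_le he
      have hsub : inverseSystem K (φ ∘ src) (φ ∘ tgt) S k =
          (edgeSpan K src tgt S k).map T := by
        rw [(ih (φ ∘ src) (φ ∘ tgt) k).1, edgeSpan_contract]
      have hmono : edgeSpan K src tgt S k ≤ edgeSpan K src tgt (insert e S) k :=
        edgeSpan_mono (Finset.subset_insert e S)
      have heq : inverseSystem K src tgt (insert e S) k = edgeSpan K src tgt (insert e S) k := by
        refine le_antisymm (fun l hl => ?_) edgeSpan_le_inverseSystem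
        have hTl : T l ∈ (edgeSpan K src tgt S k).map T := by
          rw [← hsub]
          exact map_dualMap_inverseSystem_le φ hφe ⟨l, hl, rfl⟩
        obtain ⟨l', hl', hll'⟩ := hTl
        have hd : l - l' ∈ edgeSpan K src tgt (insert e S) k :=
          hker ⟨sub_mem hl (edgeSpan_le_inverseSystem (hmono hl')), by
            rw [SetLike.mem_coe, LinearMap.mem_ker, map_sub, hll', sub_self]⟩
        simpa using add_mem hd (hmono hl')
      refine ⟨heq, ?_⟩
      have hfin : FiniteDimensional K (inverseSystem K src tgt (insert e S) k) := by
        rw [heq]; infer_instance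
      have hmap : (inverseSystem K src tgt (insert e S) k).map T =
          inverseSystem K (φ ∘ src) (φ ∘ tgt) S k := by
        refine le_antisymm (map_dualMap_inverseSystem_le φ hφe) ?_
        rw [hsub]
        exact Submodule.map_mono (hmono.trans edgeSpan_le_inverseSystem)
      rw [finrank_eq_finrank_map_add T, hmap, (ih _ _ k).2,
        forestCount_insert_of_ne (ends := fun e => s(src e, tgt e)) (e := e) rfl hne fun f hf =>
          @lt_of_le_of_ne E _ _ _ (hmax f (Finset.mem_insert_of_mem hf)) fun h => he (h ▸ hf)]
      congr 1
      rcases k with _ | k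
      · rw [hT, inverseSystem_inf_ker_zero he hne, finrank_bot, if_pos rfl]
      · have hkereq : inverseSystem K src tgt (insert e S) (k + 1) ⊓ LinearMap.ker T =
            (inverseSystem K src tgt S k).map M := by
          refine le_antisymm (inverseSystem_inf_ker_succ_le he hne) (le_inf ?_ ?_)
          · rw [(ih src tgt k).1]
            exact (map_dualMap_edgeSpan_le he).trans edgeSpan_le_inverseSystem
          · rintro _ ⟨l, -, rfl⟩
            refine LinearMap.ext fun f => ?_
            change l (edgeDeriv K (src e) (tgt e) (contractHom K φ f)) = 0
            rw [edgeDeriv_contractHom, hφe, edgeDeriv_self]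
            simp
        rw [hkereq, if_neg (Nat.succ_ne_zero k), Nat.add_sub_cancel, ← (ih src tgt k).2]
        exact (LinearEquiv.finrank_eq (Submodule.equivMapOfInjective M
          (dualMap_edgeDeriv_injective hne) _)).symm

end Dimension

lemma forestIdeal_one_eq_cutIdeal {n : ℕ} [Fintype E] (K : Type*) [Field K] (src tgt : E → Fin n) :
    forestIdeal K 1 (fun e => s(src e, tgt e)) = cutIdeal K src tgt Finset.univ := by
  classical
  have hcut : ∀ I, crossCount (fun e => s(src e, tgt e)) I = cutCount src tgt Finset.univ I := by
    intro I
    unfold crossCount cutCount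
    rw [Set.ncard_eq_toFinset_card']
    congr 1
    ext e
    simp only [Set.mem_toFinset, Set.mem_ofPred_eq, Finset.mem_filter, Finset.mem_univ, true_and,
      Sym2.mem_iff, exists_eq_or_imp, exists_eq_left]
    tauto
  unfold forestIdeal cutIdeal
  refine le_antisymm (Ideal.span_mono ?_) (Ideal.span_le.2 ?_)
  · rintro _ ⟨I, -, rfl⟩
    exact ⟨I, by simp [hcut]⟩
  · rintro _ ⟨I, rfl⟩
    rcases I.eq_empty_or_nonempty with rfl | hI
    · simp
    · exact Ideal.subset_span ⟨I, hI, by simp [hcut]⟩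

/-- For a finite multigraph `G` with a linear order `o` on its
edges and a field `K` of characteristic `0`, the dimension of the `k`-th graded
component of `B_G^{F_1}` equals the number of subforests `T` of `G` with
external activity `act_G(T) = e(G) - |T| - k` (stated as
`act_G(T) + |T| + k = e(G)`). -/
theorem gradedDim_B_F1_eq_card_subforests_act {n : ℕ} {E : Type} [Fintype E]
    [DecidableEq E] (o : LinearOrder E) (ends : E → Sym2 (Fin n))
    (K : Type) [Field K] [CharZero K] (k : ℕ) :
    gradedDim K (forestIdeal K 1 ends) k
      = Nat.card {A : Finset E // IsForest ends A ∧
          act o ends A + A.card + k = Fintype.card E} := by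
  choose src hsrc using fun e => exists_eq_mk (ends e)
  choose tgt htgt using hsrc
  obtain rfl : ends = fun e => s(src e, tgt e) := funext htgt
  rw [natCard_subforests, forestIdeal_one_eq_cutIdeal, ← finrank_inverseSystem]
  exact (inverseSystem_eq_edgeSpan_and_finrank o Finset.univ src tgt k).2

end ForestAlg
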